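/- arXiv:0704.2551 — 5 statements merged into one kernel-verified Lean document; each statement's English description precedes it below -/
import Mathlib

section
/- Let Y, X_1, …, X_p be real-valued random variables whose joint law on ℝ^{p+1} admits a density with respect to Lebesgue measure that is strictly positive almost everywhere. Then for any two subsets S₁, S₂ ⊆ {1,…,p}: if Y ⫫ (X_j)_{j∉S₁} | (X_j)_{j∈S₁} and Y ⫫ (X_j)_{j∉S₂} | (X_j)_{j∈S₂}, then Y ⫫ (X_j)_{j∉S₁∩S₂} | (X_j)_{j∈S₁∩S₂}. (This is the probabilistic core of the paper's Lemma 2: a distribution with density that factorizes according to two subgraphs of G_full also factorizes according to their intersection.) -/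
open MeasureTheory ProbabilityTheory

/-- Conditional independence of `f` and `g` given the σ-algebra generated by `w`. -/
def CondIndepFunGiven {Ω β γ δ : Type*} [mΩ : MeasurableSpace Ω] [StandardBorelSpace Ω]
    [MeasurableSpace β] [MeasurableSpace γ] [MeasurableSpace δ]
    (f : Ω → β) (g : Ω → γ) (w : Ω → δ) (hw : Measurable w)
    (μ : MeasureTheory.Measure Ω) [IsFiniteMeasure μ] : Prop :=
  ProbabilityTheory.CondIndepFun (MeasurableSpace.comap w inferInstance) hw.comap_le f g μ

open Set Filter in
lemma aux_quasi {p : ℕ} (S : Set (Fin p)) [DecidablePred (· ∈ S)] :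
    Measure.QuasiMeasurePreserving
      (fun q : (Fin p → ℝ) × (Fin p → ℝ) => S.piecewise q.1 q.2)
      ((volume : Measure (Fin p → ℝ)).prod volume) volume := by
  have he := volume_preserving_piEquivPiSubtypeProd (fun _ : Fin p => ℝ) (· ∈ S)
  have h1 := Measure.quasiMeasurePreserving_fst.comp he.quasiMeasurePreserving
  have h2 := Measure.quasiMeasurePreserving_snd.comp he.quasiMeasurePreserving
  have h3 := (he.symm _).quasiMeasurePreserving.comp (MeasureTheory.QuasiMeasurePreserving.prodMap h1 h2)
  have h4 : (fun q : (Fin p → ℝ) × (Fin p → ℝ) => S.piecewise q.1 q.2) =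
      (MeasurableEquiv.piEquivPiSubtypeProd (fun _ : Fin p => ℝ) (· ∈ S)).symm ∘
      Prod.map (Prod.fst ∘ (MeasurableEquiv.piEquivPiSubtypeProd (fun _ : Fin p => ℝ) (· ∈ S)))
        (Prod.snd ∘ (MeasurableEquiv.piEquivPiSubtypeProd (fun _ : Fin p => ℝ) (· ∈ S))) := by
    ext q j
    by_cases hj : j ∈ S <;>
      simp [Set.piecewise, MeasurableEquiv.piEquivPiSubtypeProd, Equiv.piEquivPiSubtypeProd, hj]
  rw [h4]
  exact h3

open Set Filter in
lemma aux_inter {p : ℕ} (S₁ S₂ : Set (Fin p)) (u₁ : (S₁ → ℝ) → ℝ) (u₂ : (S₂ → ℝ) → ℝ)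
    (hu₁ : Measurable u₁)
    (h : ∀ᵐ x ∂(volume : Measure (Fin p → ℝ)), u₁ (fun j => x j) = u₂ (fun j => x j)) :
    ∃ u : (↥(S₁ ∩ S₂) → ℝ) → ℝ, Measurable u ∧
      ∀ᵐ x ∂(volume : Measure (Fin p → ℝ)), u₁ (fun j => x j) = u (fun j => x j) := by
  classical
  have a1 := (aux_quasi S₁).ae h
  have a2 := (aux_quasi (S₁ ∩ S₂)).ae h
  have a3 : ∀ᵐ q ∂((volume : Measure (Fin p → ℝ)).prod (volume : Measure (Fin p → ℝ))),
      u₁ (fun j => q.1 j) = u₁ (fun j => (S₁ ∩ S₂).piecewise q.1 q.2 j) := by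
    filter_upwards [a1, a2] with q h1 h2
    rw [h2]
    have e1 : (fun j : S₁ => S₁.piecewise q.1 q.2 j) = fun j : S₁ => q.1 j := by
      ext j; simp
    have e2 : (fun j : S₂ => S₁.piecewise q.1 q.2 j)
        = fun j : S₂ => (S₁ ∩ S₂).piecewise q.1 q.2 j := by
      ext j; by_cases hj : (j : Fin p) ∈ S₁ <;> simp [Set.piecewise, hj]
    rw [e1, e2] at h1
    exact h1
  have a4 := (Measure.measurePreserving_swap (μ := (volume : Measure (Fin p → ℝ)))
    (ν := (volume : Measure (Fin p → ℝ)))).quasiMeasurePreserving.ae a3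
  obtain ⟨z, hz⟩ := (Measure.ae_ae_of_ae_prod a4).exists
  refine ⟨fun w => u₁ (fun j => if hj : (j : Fin p) ∈ S₁ ∩ S₂ then w ⟨j, hj⟩ else z j), ?_, ?_⟩
  · refine hu₁.comp (measurable_pi_lambda _ fun j => ?_)
    by_cases hj : (j : Fin p) ∈ S₁ ∩ S₂
    · simp only [hj, dif_pos]; exact measurable_pi_apply _
    · simp only [hj]; exact measurable_const
  · filter_upwards [hz] with x hx
    simp only [Prod.swap] at hx
    rw [hx]
    congr 1

lemma aux_sub {Ω : Type*} {m : MeasurableSpace Ω} {p : ℕ} {X : Fin p → Ω → ℝ}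
    (h : Measurable (fun ω j => X j ω)) (q : Fin p → Prop) :
    Measurable (fun ω (j : {j : Fin p // q j}) => X j.1 ω) :=
  measurable_pi_lambda _ fun j => (measurable_pi_apply j.1).comp h

lemma aux_pair {Ω : Type*} {m : MeasurableSpace Ω} {p : ℕ} {X : Fin p → Ω → ℝ} (S : Set (Fin p)) :
    Measurable (fun ω j => X j ω) ↔ Measurable (fun ω => ((fun j : S => X j.1 ω),
      (fun j : {j : Fin p // j ∉ S} => X j.1 ω))) := by
  refine ⟨fun h => (aux_sub h (· ∈ S)).prodMk (aux_sub h (· ∉ S)), fun h => ?_⟩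
  refine measurable_pi_lambda _ fun j => ?_
  by_cases hj : j ∈ S
  · exact (measurable_pi_apply (⟨j, hj⟩ : S)).comp (measurable_fst.comp h)
  · exact (measurable_pi_apply (⟨j, hj⟩ : {j // j ∉ S})).comp (measurable_snd.comp h)

lemma aux_comap {Ω : Type*} {p : ℕ} (X : Fin p → Ω → ℝ) (S : Set (Fin p)) :
    MeasurableSpace.comap (fun ω => ((fun j : S => X j.1 ω),
      (fun j : {j : Fin p // j ∉ S} => X j.1 ω))) inferInstance
    = MeasurableSpace.comap (fun ω j => X j ω) inferInstance := by
  apply le_antisymm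
  · rw [← measurable_iff_comap_le]
    exact (aux_pair S).1 (comap_measurable (m := MeasurableSpace.pi) _)
  · rw [← measurable_iff_comap_le]
    exact (aux_pair S).2 (comap_measurable (m := inferInstance) _)

lemma aux_fwd {Ω : Type*} [MeasurableSpace Ω] [StandardBorelSpace Ω]
    (P : Measure Ω) [IsProbabilityMeasure P] {p : ℕ}
    (Y : Ω → ℝ) (X : Fin p → Ω → ℝ)
    (hY : Measurable Y) (hX : ∀ j, Measurable (X j)) (S : Set (Fin p))
    (h : CondIndepFunGiven Y
      (fun ω (j : {j : Fin p // j ∉ S}) => X j.1 ω)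
      (fun ω (j : S) => X j.1 ω)
      (measurable_pi_lambda _ fun j => hX j.1) P) {A : Set ℝ} (hA : MeasurableSet A) :
    ∃ u : (S → ℝ) → ℝ, Measurable u ∧
      P⟦Y ⁻¹' A | MeasurableSpace.comap (fun ω j => X j ω) inferInstance⟧
        =ᵐ[P] fun ω => u (fun j => X j.1 ω) := by
  have hk : Measurable (fun ω (j : S) => X j.1 ω) := measurable_pi_lambda _ fun j => hX j.1
  have hl : Measurable (fun ω (j : {j : Fin p // j ∉ S}) => X j.1 ω) :=
    measurable_pi_lambda _ fun j => hX j.1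
  have h' := (condIndepFun_iff_condDistrib_prod_ae_eq_prodMkRight hY hl hk).1
    (CondIndepFun.symm h)
  have h2 := ae_of_ae_map (hk.prodMk hl).aemeasurable h'
  have h3 := condDistrib_ae_eq_condExp (μ := P) (hk.prodMk hl) hY hA
  refine ⟨fun w => (condDistrib Y (fun ω (j : S) => X j.1 ω) P w).real A,
    (Kernel.measurable_coe _ hA).ennreal_toReal, ?_⟩
  rw [← aux_comap X S]
  filter_upwards [h2, h3] with ω e2 e3
  rw [← e3, e2]
  rfl

lemma aux_bwd {Ω : Type*} {m' mX mΩ : MeasurableSpace Ω} (P : Measure Ω) [IsProbabilityMeasure P]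
    (hle : m' ≤ mX) (hXle : mX ≤ mΩ) {A T : Set Ω} (hA : MeasurableSet[mΩ] A)
    (hTX : MeasurableSet[mX] T) {F : Ω → ℝ} (hFm : StronglyMeasurable[m'] F)
    (hFX : P⟦A | mX⟧ =ᵐ[P] F) :
    P⟦A ∩ T | m'⟧ =ᵐ[P] fun ω => (P⟦A | m'⟧) ω * (P⟦T | m'⟧) ω := by
  have hTm : MeasurableSet[mΩ] T := hXle _ hTX
  have hFi : Integrable F P := integrable_condExp.congr hFX
  have hF' : P⟦A | m'⟧ =ᵐ[P] F := by
    refine (condExp_condExp_of_le hle hXle).symm.trans ((condExp_congr_ae hFX).trans ?_)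
    rw [condExp_of_stronglyMeasurable (hle.trans hXle) hFm hFi]
  have hiT : Integrable (T.indicator (fun _ => (1:ℝ))) P := (integrable_const _).indicator hTm
  have hiA : Integrable (A.indicator (fun _ => (1:ℝ))) P :=
    (integrable_const _).indicator hA
  have hprod : (A ∩ T).indicator (fun _ => (1:ℝ))
      = A.indicator (fun _ => (1:ℝ)) * T.indicator (fun _ => (1:ℝ)) := by
    ext ω
    by_cases c1 : ω ∈ A <;> by_cases c2 : ω ∈ T <;> simp [Set.indicator, c1, c2]
  have hiAT : Integrable (A.indicator (fun _ => (1:ℝ)) * T.indicator (fun _ => (1:ℝ))) P :=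
    hprod ▸ (integrable_const _).indicator (hA.inter hTm)
  have hTs : StronglyMeasurable[mX] (T.indicator (fun _ => (1:ℝ))) :=
    stronglyMeasurable_const.indicator hTX
  have s1 := condExp_mul_of_stronglyMeasurable_right hTs hiAT hiA
  have s2 : P[A.indicator (fun _ => (1:ℝ)) * T.indicator (fun _ => (1:ℝ)) | mX] =ᵐ[P]
      F * T.indicator (fun _ => (1:ℝ)) :=
    s1.trans (hFX.mul (ae_eq_refl _))
  have hiF : Integrable (F * T.indicator (fun _ => (1:ℝ))) P :=
    integrable_condExp.congr s2
  have s3 := condExp_mul_of_stronglyMeasurable_left hFm hiF hiT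
  have s4 := (condExp_condExp_of_le hle hXle).symm.trans ((condExp_congr_ae s2).trans s3)
  rw [← hprod] at s4
  filter_upwards [s4, hF'] with ω c1 c2
  rw [c1, c2]
  rfl

/-- If the joint law of `(Y, X₁, …, X_p)` has an a.e. strictly positive density
with respect to Lebesgue measure on `ℝ^{p+1}`, and `Y` is conditionally independent of the
variables outside `S₁` given those in `S₁`, and likewise for `S₂`, then the same holds
for `S₁ ∩ S₂`. -/
theorem stmt_0 {Ω : Type*} [MeasurableSpace Ω] [StandardBorelSpace Ω]
    (P : Measure Ω) [IsProbabilityMeasure P] {p : ℕ}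
    (Y : Ω → ℝ) (X : Fin p → Ω → ℝ)
    (hY : Measurable Y) (hX : ∀ j, Measurable (X j))
    (g : ℝ × (Fin p → ℝ) → ENNReal) (hg : Measurable g)
    (hlaw : Measure.map (fun ω => (Y ω, fun j => X j ω)) P
      = (volume : Measure (ℝ × (Fin p → ℝ))).withDensity g)
    (hpos : ∀ᵐ x ∂(volume : Measure (ℝ × (Fin p → ℝ))), 0 < g x)
    (S₁ S₂ : Set (Fin p))
    (h₁ : CondIndepFunGiven Y
      (fun ω (j : {j : Fin p // j ∉ S₁}) => X j.1 ω)
      (fun ω (j : S₁) => X j.1 ω)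
      (measurable_pi_lambda _ fun j => hX j.1) P)
    (h₂ : CondIndepFunGiven Y
      (fun ω (j : {j : Fin p // j ∉ S₂}) => X j.1 ω)
      (fun ω (j : S₂) => X j.1 ω)
      (measurable_pi_lambda _ fun j => hX j.1) P) :
    CondIndepFunGiven Y
      (fun ω (j : {j : Fin p // j ∉ S₁ ∩ S₂}) => X j.1 ω)
      (fun ω (j : ↥(S₁ ∩ S₂)) => X j.1 ω)
      (measurable_pi_lambda _ fun j => hX j.1) P := by
  have hXX : Measurable (fun ω j => X j ω) := measurable_pi_lambda _ hX
  have hk : Measurable (fun ω (j : ↥(S₁ ∩ S₂)) => X j.1 ω) :=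
    measurable_pi_lambda _ fun j => hX j.1
  have hl : Measurable (fun ω (j : {j : Fin p // j ∉ S₁ ∩ S₂}) => X j.1 ω) :=
    measurable_pi_lambda _ fun j => hX j.1
  unfold CondIndepFunGiven
  rw [condIndepFun_iff_condExp_inter_preimage_eq_mul hY hl]
  intro A B hA hB
  obtain ⟨u₁, hu₁, e₁⟩ := aux_fwd P Y X hY hX S₁ h₁ hA
  obtain ⟨u₂, hu₂, e₂⟩ := aux_fwd P Y X hY hX S₂ h₂ hA
  have hm : MeasurableSet {x : Fin p → ℝ | u₁ (fun j => x j) = u₂ (fun j => x j)} :=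
    measurableSet_eq_fun (by fun_prop) (by fun_prop)
  have hvol : ∀ᵐ x ∂(volume : Measure (Fin p → ℝ)), u₁ (fun j => x j) = u₂ (fun j => x j) := by
    have b1 : ∀ᵐ q ∂(Measure.map (fun ω => (Y ω, fun j => X j ω)) P),
        u₁ (fun j => q.2 j) = u₂ (fun j => q.2 j) := by
      refine (ae_map_iff (hY.prodMk hXX).aemeasurable (measurable_snd hm)).2 ?_
      filter_upwards [e₁, e₂] with ω c1 c2
      exact c1.symm.trans c2
    rw [hlaw, ae_withDensity_iff hg] at b1
    have b2 : ∀ᵐ q ∂((volume : Measure ℝ).prod (volume : Measure (Fin p → ℝ))),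
        u₁ (fun j => q.2 j) = u₂ (fun j => q.2 j) := by
      filter_upwards [b1, hpos] with q c1 c2 using c1 c2.ne'
    exact (Measure.ae_ae_of_ae_prod b2).exists.choose_spec
  obtain ⟨u, hu, hue⟩ := aux_inter S₁ S₂ u₁ u₂ hu₁ hvol
  have hue' : ∀ᵐ ω ∂P, u₁ (fun j => X j ω) = u (fun j => X j ω) := by
    have b2 : ∀ᵐ q ∂((volume : Measure ℝ).prod (volume : Measure (Fin p → ℝ))),
        u₁ (fun j => q.2 j) = u (fun j => q.2 j) :=
      Measure.quasiMeasurePreserving_snd.ae hue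
    have b3 := (withDensity_absolutelyContinuous
      (volume : Measure (ℝ × (Fin p → ℝ))) g).ae_le b2
    rw [← hlaw] at b3
    exact ae_of_ae_map (hY.prodMk hXX).aemeasurable b3
  have hXm := comap_measurable (m := MeasurableSpace.pi) (fun ω (j : Fin p) => X j ω)
  refine aux_bwd P (mX := MeasurableSpace.comap (fun ω j => X j ω) inferInstance) ?_
    hXX.comap_le (hY hA) ?_ (F := fun ω => u (fun j => X j.1 ω)) ?_ ?_
  · rw [← measurable_iff_comap_le]
    exact aux_sub hXm (· ∈ S₁ ∩ S₂)
  · have : Measurable[MeasurableSpace.comap (fun ω j => X j ω) inferInstance]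
        (fun ω (j : {j : Fin p // j ∉ S₁ ∩ S₂}) => X j.1 ω) :=
      aux_sub hXm (· ∉ S₁ ∩ S₂)
    exact this hB
  · exact (hu.comp (comap_measurable (fun ω (j : ↥(S₁ ∩ S₂)) => X j.1 ω))).stronglyMeasurable
  · filter_upwards [e₁, hue'] with ω c1 c2
    exact c1.trans c2
end

section
/- Let g : ℝ × (Fin p → ℝ) → [0,∞) be a measurable probability density with respect to Lebesgue measure on ℝ^{p+1} that is strictly positive almost everywhere. For a subset S ⊆ Fin p write g_S for the marginal density of the coordinates (x_j)_{j∈S} (obtained by integrating g over y and over the coordinates x_j, j ∉ S), g_{Y,S} for the marginal density of (y, (x_j)_{j∈S}), and g_X for the marginal density of x = (x_1,…,x_p). Suppose S₁, S₂ ⊆ Fin p are such that g(y,x)·g_{S₁}((x_j)_{j∈S₁}) = g_{Y,S₁}(y,(x_j)_{j∈S₁})·g_X(x) for Lebesgue-a.e. (y,x), and likewise with S₂ in place of S₁. Then g(y,x)·g_{S₁∩S₂}((x_j)_{j∈S₁∩S₂}) = g_{Y,S₁∩S₂}(y,(x_j)_{j∈S₁∩S₂})·g_X(x) for Lebesgue-a.e.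 (y,x). (This is the density identity established in the proof of the paper's Lemma 2: if the conditional density of Y given X depends only on the coordinates in S₁ and only on the coordinates in S₂, then it depends only on the coordinates in S₁∩S₂.) -/
open MeasureTheory

/-- Reassemble a full vector of coordinates from the coordinates in `S` and those outside `S`. -/
noncomputable def combine {p : ℕ} (S : Finset (Fin p)) (xS : {j : Fin p // j ∈ S} → ℝ)
    (z : {j : Fin p // j ∉ S} → ℝ) : Fin p → ℝ :=
  fun j => if h : j ∈ S then xS ⟨j, h⟩ else z ⟨j, h⟩

/-- Marginal density of the coordinates `x = (x₁,…,x_p)` (integrating out `y`). -/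
noncomputable def margX {p : ℕ} (g : ℝ × (Fin p → ℝ) → ENNReal) : (Fin p → ℝ) → ENNReal :=
  fun x => ∫⁻ y, g (y, x)

/-- Marginal density of the coordinates `(x_j)_{j ∈ S}` (integrating out `y` and the
coordinates outside `S`). -/
noncomputable def margS {p : ℕ} (g : ℝ × (Fin p → ℝ) → ENNReal) (S : Finset (Fin p)) :
    ({j : Fin p // j ∈ S} → ℝ) → ENNReal :=
  fun xS => ∫⁻ y, ∫⁻ z : {j : Fin p // j ∉ S} → ℝ, g (y, combine S xS z)

/-- Marginal density of `(y, (x_j)_{j ∈ S})` (integrating out the coordinates outside `S`). -/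
noncomputable def margYS {p : ℕ} (g : ℝ × (Fin p → ℝ) → ENNReal) (S : Finset (Fin p)) :
    ℝ × ({j : Fin p // j ∈ S} → ℝ) → ENNReal :=
  fun yx => ∫⁻ z : {j : Fin p // j ∉ S} → ℝ, g (yx.1, combine S yx.2 z)


lemma qmp_restrict {ι κ : Type*} [Fintype ι] [Fintype κ] (σ : ι → κ)
    (hσ : Function.Injective σ) :
    Measure.QuasiMeasurePreserving (fun (x : κ → ℝ) (i : ι) => x (σ i)) volume volume := by
  classical
  have e1 := (volume_preserving_piEquivPiSubtypeProd (fun _ : κ => ℝ)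
    (fun k => ∃ i, σ i = k)).quasiMeasurePreserving
  have e2 : Measure.QuasiMeasurePreserving
      (Prod.fst : ({k // ∃ i, σ i = k} → ℝ) × ({k // ¬ (∃ i, σ i = k)} → ℝ) → _)
      volume volume :=
    Measure.quasiMeasurePreserving_fst
  let E : {k // ∃ i, σ i = k} ≃ ι := (Equiv.ofInjective σ hσ).symm
  have e3 := (volume_measurePreserving_piCongrLeft (fun _ : ι => ℝ) E).quasiMeasurePreserving
  have e4 := e3.comp (e2.comp e1)
  refine (congrArg (fun f => Measure.QuasiMeasurePreserving f volume volume) ?_).mpr e4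
  funext x i
  obtain ⟨k, rfl⟩ := E.surjective i
  simp only [Function.comp_apply]
  rw [MeasurableEquiv.piCongrLeft_apply_apply (β := fun _ : ι => ℝ)]
  have hk : σ (E k) = k.1 := Equiv.apply_ofInjective_symm hσ k
  rw [hk]
  rfl

lemma qmp_sum {ι κ τ : Type*} [Fintype ι] [Fintype κ] [Fintype τ] (σ : ι → κ ⊕ τ)
    (hσ : Function.Injective σ) :
    Measure.QuasiMeasurePreserving
      (fun (u : ℝ × ((κ → ℝ) × (τ → ℝ))) => (u.1, fun i => Sum.elim u.2.1 u.2.2 (σ i)))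
      volume (volume : Measure (ℝ × (ι → ℝ))) := by
  have e1 := (volume_measurePreserving_sumPiEquivProdPi_symm
    (fun _ : κ ⊕ τ => ℝ)).quasiMeasurePreserving
  have e2 := (qmp_restrict σ hσ).comp e1
  have e3 := QuasiMeasurePreserving.prodMap
    (Measure.QuasiMeasurePreserving.id (volume : Measure ℝ)) e2
  refine (congrArg (fun f => Measure.QuasiMeasurePreserving f volume volume) ?_).mpr e3
  funext u
  ext i
  · rfl
  · simp only [Prod.map, Function.comp_apply]
    cases h : σ i <;> rfl

lemma qmp_main {ι κ τ : Type*} [Fintype ι] [Fintype κ] [Fintype τ] (σ : ι → κ ⊕ τ)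
    (hσ : Function.Injective σ) {P : ℝ × (ι → ℝ) → Prop}
    (hP : ∀ᵐ u ∂(volume : Measure (ℝ × (ι → ℝ))), P u) :
    ∀ᵐ yx ∂(volume : Measure (ℝ × (κ → ℝ))), ∀ᵐ z ∂(volume : Measure (τ → ℝ)),
      P (yx.1, fun i => Sum.elim yx.2 z (σ i)) := by
  have e := (qmp_sum σ hσ).comp
    (volume_preserving_prodAssoc (α₁ := ℝ) (β₁ := κ → ℝ) (γ₁ := τ → ℝ)).quasiMeasurePreserving
  exact Measure.ae_ae_of_ae_prod (e.ae hP)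

lemma measurable_combine {p : ℕ} (S : Finset (Fin p)) :
    Measurable (fun u : ({j : Fin p // j ∈ S} → ℝ) × ({j : Fin p // j ∉ S} → ℝ) =>
      combine S u.1 u.2) := by
  refine measurable_pi_lambda _ fun j => ?_
  by_cases h : j ∈ S
  · simp only [combine, h, dif_pos]; fun_prop
  · simp only [combine, h, dif_neg, not_false_eq_true]; fun_prop

lemma measurable_margX {p : ℕ} (g : ℝ × (Fin p → ℝ) → ENNReal) (hg : Measurable g) :
    Measurable (margX g) :=
  Measurable.lintegral_prod_left' hg

lemma measurable_combine_right {p : ℕ} (S : Finset (Fin p)) (a) :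
    Measurable (combine S a) :=
  (measurable_combine S).comp measurable_prodMk_left

lemma margS_eq {p : ℕ} (g : ℝ × (Fin p → ℝ) → ENNReal) (hg : Measurable g)
    (S : Finset (Fin p)) (a) : margS g S a = ∫⁻ z, margX g (combine S a z) := by
  unfold margS margX
  refine lintegral_lintegral_swap (Measurable.aemeasurable ?_)
  exact hg.comp (measurable_fst.prodMk ((measurable_combine_right S a).comp measurable_snd))

lemma lintegral_margX {p : ℕ} (g : ℝ × (Fin p → ℝ) → ENNReal) (hg : Measurable g)
    (hprob : ∫⁻ yx : ℝ × (Fin p → ℝ), g yx = 1) : ∫⁻ x, margX g x = 1 := by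
  rw [← hprob]
  exact (lintegral_prod_symm _ hg.aemeasurable).symm

lemma lintegral_margS {p : ℕ} (g : ℝ × (Fin p → ℝ) → ENNReal) (hg : Measurable g)
    (hprob : ∫⁻ yx : ℝ × (Fin p → ℝ), g yx = 1) (S : Finset (Fin p)) :
    ∫⁻ a, margS g S a = 1 := by
  rw [← lintegral_margX g hg hprob]
  have e : MeasurePreserving
      (MeasurableEquiv.piEquivPiSubtypeProd (fun _ : Fin p => ℝ) (fun k => k ∈ S)).symm
      ((volume : Measure ({j : Fin p // j ∈ S} → ℝ)).prod volume) volume := by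
    have e0 := (volume_preserving_piEquivPiSubtypeProd (fun _ : Fin p => ℝ)
      (fun k => k ∈ S)).symm
    have hi : (Subtype.fintype fun k => k ∈ S) = (Finset.Subtype.fintype S) :=
      Subsingleton.elim _ _
    rw [hi] at e0
    exact e0
  rw [← e.lintegral_comp (measurable_margX g hg)]
  simp_rw [margS_eq g hg]
  exact (lintegral_prod (μ := volume) (ν := volume)
    (fun u : ({j : Fin p // j ∈ S} → ℝ) × ({j : Fin p // j ∉ S} → ℝ) =>
      margX g (combine S u.1 u.2))
    ((measurable_margX g hg).comp (measurable_combine S)).aemeasurable).symm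

lemma measurable_margS {p : ℕ} (g : ℝ × (Fin p → ℝ) → ENNReal) (hg : Measurable g)
    (S : Finset (Fin p)) : Measurable (margS g S) := by
  have : margS g S = fun a => ∫⁻ z, margX g (combine S a z) := funext (margS_eq g hg S)
  rw [this]
  exact Measurable.lintegral_prod_right'
    (f := fun u : ({j : Fin p // j ∈ S} → ℝ) × ({j : Fin p // j ∉ S} → ℝ) =>
      margX g (combine S u.1 u.2))
    ((measurable_margX g hg).comp (measurable_combine S))

lemma ae_margX {p : ℕ} (g : ℝ × (Fin p → ℝ) → ENNReal) (hg : Measurable g)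
    (hprob : ∫⁻ yx : ℝ × (Fin p → ℝ), g yx = 1)
    (hpos : ∀ᵐ yx ∂(volume : Measure (ℝ × (Fin p → ℝ))), 0 < g yx) :
    ∀ᵐ yx ∂(volume : Measure (ℝ × (Fin p → ℝ))), margX g yx.2 ≠ 0 ∧ margX g yx.2 ≠ ⊤ := by
  have q : Measure.QuasiMeasurePreserving (Prod.snd : ℝ × (Fin p → ℝ) → _) volume volume :=
    Measure.quasiMeasurePreserving_snd
  refine q.ae (p := fun x => margX g x ≠ 0 ∧ margX g x ≠ ⊤) ?_
  have h1 : ∀ᵐ x, margX g x < ⊤ := ae_lt_top (measurable_margX g hg)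
    (by rw [lintegral_margX g hg hprob]; simp)
  have h2 : ∀ᵐ x : Fin p → ℝ, ∀ᵐ y : ℝ, 0 < g (y, x) :=
    Measure.ae_ae_of_ae_prod
      ((Measure.measurePreserving_swap (μ := (volume : Measure (Fin p → ℝ)))
        (ν := (volume : Measure ℝ))).quasiMeasurePreserving.ae hpos)
  filter_upwards [h1, h2] with x hx1 hx2
  refine ⟨fun h0 => ?_, hx1.ne⟩
  have := (lintegral_eq_zero_iff (hg.comp measurable_prodMk_right)).1 h0
  have hF : ∀ᵐ y : ℝ, False := by
    filter_upwards [this, hx2] with y a b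
    exact b.ne' a
  exact hF.exists.elim fun _ h => h

lemma combine_eq {p : ℕ} (S : Finset (Fin p)) (x : Fin p → ℝ) (z) :
    combine S (fun j => x j.1) z
      = fun i => Sum.elim x z (if h : i ∈ S then Sum.inl i else Sum.inr ⟨i, h⟩) := by
  funext i
  unfold combine
  split_ifs <;> rfl

lemma inj_aux {p : ℕ} (S T : Finset (Fin p)) (hTS : T ⊆ S) : Function.Injective
    (fun i => if h : i ∈ S then Sum.inl i else Sum.inr ⟨i, fun h' => h (hTS h')⟩ :
      Fin p → Fin p ⊕ {j : Fin p // j ∉ T}) := by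
  intro i j h
  dsimp only at h
  split_ifs at h <;> simp_all

lemma ae_margS {p : ℕ} (g : ℝ × (Fin p → ℝ) → ENNReal) (hg : Measurable g)
    (hprob : ∫⁻ yx : ℝ × (Fin p → ℝ), g yx = 1)
    (hpos : ∀ᵐ yx ∂(volume : Measure (ℝ × (Fin p → ℝ))), 0 < g yx) (S : Finset (Fin p)) :
    ∀ᵐ yx ∂(volume : Measure (ℝ × (Fin p → ℝ))),
      margS g S (fun j => yx.2 j.1) ≠ 0 ∧ margS g S (fun j => yx.2 j.1) ≠ ⊤ := by
  have h1 : ∀ᵐ x, margS g S x < ⊤ := ae_lt_top (measurable_margS g hg S)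
    (by rw [lintegral_margS g hg hprob]; simp)
  have q : Measure.QuasiMeasurePreserving (Prod.snd : ℝ × (Fin p → ℝ) → _) volume volume :=
    Measure.quasiMeasurePreserving_snd
  have h2 := ((qmp_restrict (fun j : {j : Fin p // j ∈ S} => j.1)
    Subtype.val_injective).comp q).ae h1
  have h3 := qmp_main _ (inj_aux S S (Finset.Subset.refl _)) (ae_margX g hg hprob hpos)
  filter_upwards [h2, h3] with yx a b
  refine ⟨fun h0 => ?_, a.ne⟩
  rw [margS_eq g hg] at h0
  replace h0 := (lintegral_eq_zero_iff
    ((measurable_margX g hg).comp (measurable_combine_right S _))).1 h0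
  have hF : ∀ᵐ z : {j : Fin p // j ∉ S} → ℝ, False := by
    filter_upwards [h0, b] with z a b
    refine b.1 ?_
    rw [← combine_eq]
    exact a
  exact hF.exists.elim fun _ h => h

lemma cancel_aux {a a' s b X X' : ENNReal} (h : a * s = b * X) (h' : a' * s = b * X')
    (h0 : s ≠ 0) (h1 : s ≠ ⊤) : a * X' = a' * X := by
  refine (ENNReal.mul_left_inj h0 h1).1 ?_
  calc a * X' * s = (a * s) * X' := by ring
    _ = (b * X') * X := by rw [h]; ring
    _ = a' * X * s := by rw [← h']; ring

lemma cancel_aux2 {a b c X Y Z : ENNReal} (h : a * Y = b * X) (h' : b * Z = c * Y)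
    (h0 : Y ≠ 0) (h1 : Y ≠ ⊤) : a * Z = c * X := by
  refine (ENNReal.mul_left_inj h0 h1).1 ?_
  calc a * Z * Y = (a * Y) * Z := by ring
    _ = (b * Z) * X := by rw [h]; ring
    _ = c * X * Y := by rw [h']; ring

/-- If a strictly positive probability density `g` on `ℝ^{p+1}` satisfies the
factorization identity `g · g_{S} = g_{Y,S} · g_X` a.e. for `S = S₁` and `S = S₂`, then it
satisfies it for `S = S₁ ∩ S₂`. -/
theorem stmt_1 {p : ℕ} (g : ℝ × (Fin p → ℝ) → ENNReal) (hg : Measurable g)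
    (hprob : ∫⁻ yx : ℝ × (Fin p → ℝ), g yx = 1)
    (hpos : ∀ᵐ yx ∂(volume : Measure (ℝ × (Fin p → ℝ))), 0 < g yx)
    (S₁ S₂ : Finset (Fin p))
    (h₁ : ∀ᵐ yx ∂(volume : Measure (ℝ × (Fin p → ℝ))),
      g yx * margS g S₁ (fun j => yx.2 j.1)
        = margYS g S₁ (yx.1, fun j => yx.2 j.1) * margX g yx.2)
    (h₂ : ∀ᵐ yx ∂(volume : Measure (ℝ × (Fin p → ℝ))),
      g yx * margS g S₂ (fun j => yx.2 j.1)
        = margYS g S₂ (yx.1, fun j => yx.2 j.1) * margX g yx.2) :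
    ∀ᵐ yx ∂(volume : Measure (ℝ × (Fin p → ℝ))),
      g yx * margS g (S₁ ∩ S₂) (fun j => yx.2 j.1)
        = margYS g (S₁ ∩ S₂) (yx.1, fun j => yx.2 j.1) * margX g yx.2 := by
  classical
  have hX := ae_margX g hg hprob hpos
  have H := (h₁.and h₂).and (hX.and ((ae_margS g hg hprob hpos S₁).and
    (ae_margS g hg hprob hpos S₂)))
  have Hv := qmp_main _ (inj_aux S₁ (S₁ ∩ S₂) Finset.inter_subset_left) H
  have Hw := qmp_main _ (inj_aux (S₁ ∩ S₂) (S₁ ∩ S₂) (Finset.Subset.refl _)) H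
  filter_upwards [H, Hv, Hw] with yx Hx Hv Hw
  obtain ⟨y, x⟩ := yx
  have key : ∀ᵐ z : {j : Fin p // j ∉ S₁ ∩ S₂} → ℝ,
      g (y, x) * margX g (combine (S₁ ∩ S₂) (fun j => x j.1) z)
        = g (y, combine (S₁ ∩ S₂) (fun j => x j.1) z) * margX g x := by
    filter_upwards [Hv, Hw] with z Hv Hw
    rw [combine_eq]
    dsimp only at Hx Hv Hw ⊢
    set w : Fin p → ℝ := fun i => Sum.elim x z
      (if h : i ∈ S₁ ∩ S₂ then Sum.inl i else Sum.inr ⟨i, h⟩) with hw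
    set v : Fin p → ℝ := fun i => Sum.elim x z
      (if h : i ∈ S₁ then Sum.inl i else
        Sum.inr ⟨i, fun h' => h (Finset.inter_subset_left h')⟩) with hv
    have e1 : (fun j : {j // j ∈ S₁} => v j.1) = fun j => x j.1 := by
      funext j
      simp [hv, j.2]
    have e2 : (fun j : {j // j ∈ S₂} => v j.1) = fun j => w j.1 := by
      funext j
      by_cases h : j.1 ∈ S₁ <;> simp [hv, hw, j.2, h]
    obtain ⟨⟨x1, -⟩, -, ⟨s0, s1⟩, -⟩ := Hx
    obtain ⟨⟨v1, v2⟩, ⟨vX0, vX1⟩, -, -⟩ := Hv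
    obtain ⟨⟨-, w2⟩, -, -, ⟨t0, t1⟩⟩ := Hw
    rw [e1] at v1
    rw [e2] at v2
    exact cancel_aux2 (cancel_aux x1 v1 s0 s1) (cancel_aux v2 w2 t0 t1) vX0 vX1
  have mX : Measurable (fun z => margX g (combine (S₁ ∩ S₂) (fun j => x j.1) z)) :=
    (measurable_margX g hg).comp (measurable_combine_right (S₁ ∩ S₂) (fun j => x j.1))
  have mg : Measurable (fun z => g (y, combine (S₁ ∩ S₂) (fun j => x j.1) z)) :=
    hg.comp (measurable_const.prodMk (measurable_combine_right (S₁ ∩ S₂) (fun j => x j.1)))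
  dsimp only
  rw [margS_eq g hg]
  unfold margYS
  rw [← lintegral_const_mul _ mX, ← lintegral_mul_const _ mg]
  exact lintegral_congr_ae key
end

section
/- Let Y, X_1, …, X_p be real-valued random variables whose joint law on ℝ^{p+1} admits a density with respect to Lebesgue measure that is strictly positive almost everywhere. Define pa := { j ∈ {1,…,p} : Y and X_j are NOT conditionally independent given (X_k)_{k≠j} }. Then: (i) Y ⫫ (X_j)_{j∉pa} | (X_j)_{j∈pa}; and (ii) pa is the smallest such set: every S ⊆ {1,…,p} with Y ⫫ (X_j)_{j∉S} | (X_j)_{j∈S} satisfies pa ⊆ S. (This is the single-node probabilistic content of the paper's Proposition 3: the set of parents of a variable in the minimal DAG G̃ is exactly the set of full-order conditional dependencies, and it is the smallest conditioning set that renders the variable independent of all the remaining conditioning variables.) -/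
open MeasureTheory ProbabilityTheory

theorem aux_condIndep {Ω β γ δ : Type*} [mΩ : MeasurableSpace Ω] [StandardBorelSpace Ω]
    [MeasurableSpace β] [mγ : MeasurableSpace γ] [mδ : MeasurableSpace δ]
    [StandardBorelSpace β] [Nonempty β] [StandardBorelSpace γ] [Nonempty γ]
    (Y : Ω → β) (V : Ω → γ) (W : Ω → δ) (hY : Measurable Y) (hV : Measurable V)
    (hW : Measurable W) (P : Measure Ω) [IsFiniteMeasure P] :
    CondIndepFunGiven Y V W hW P ↔ ∀ s, MeasurableSet s → ∃ F : δ → ℝ, Measurable F ∧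
      P⟦Y ⁻¹' s | MeasurableSpace.comap (fun ω => (W ω, V ω)) inferInstance⟧ =ᵐ[P] F ∘ W := by
  unfold CondIndepFunGiven
  have hWV : Measurable (fun ω => (W ω, V ω)) := hW.prodMk hV
  constructor
  · intro h s hs
    have h2 := (condIndepFun_iff_condDistrib_prod_ae_eq_prodMkRight hY hV hW).1 h.symm
    refine ⟨fun w => (condDistrib Y W P w).real s,
      (Kernel.measurable_coe _ hs).ennreal_toReal, ?_⟩
    have h3 := ae_of_ae_map hWV.aemeasurable h2
    filter_upwards [h3, condDistrib_ae_eq_condExp (μ := P) hWV hY hs] with ω h4 h5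
    rw [← h5, h4]
    simp
  · intro h
    rw [condIndepFun_iff_condExp_inter_preimage_eq_mul hY hV]
    intro s t hs ht
    obtain ⟨F, hF, hFe⟩ := h s hs
    set m : MeasurableSpace Ω := MeasurableSpace.comap (fun ω => (W ω, V ω)) inferInstance with hm
    set m' : MeasurableSpace Ω := MeasurableSpace.comap W inferInstance with hm'
    have hmle : m ≤ mΩ := hWV.comap_le
    have hW' : Measurable[m] W := measurable_fst.comp (comap_measurable (fun ω => (W ω, V ω)))
    have hV' : Measurable[m] V := measurable_snd.comp (comap_measurable (fun ω => (W ω, V ω)))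
    have hm'm : m' ≤ m := hW'.comap_le
    have hFW : StronglyMeasurable[m'] (F ∘ W) :=
      (hF.comp (comap_measurable W)).stronglyMeasurable
    have iA : Integrable ((Y ⁻¹' s).indicator (fun _ => (1 : ℝ))) P :=
      (integrable_const _).indicator (hY hs)
    have iC : Integrable ((V ⁻¹' t).indicator (fun _ => (1 : ℝ))) P :=
      (integrable_const _).indicator (hV ht)
    have hAC : (Y ⁻¹' s ∩ V ⁻¹' t).indicator (fun _ => (1 : ℝ)) =
        (Y ⁻¹' s).indicator (fun _ => (1 : ℝ)) * (V ⁻¹' t).indicator (fun _ => (1 : ℝ)) := by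
      ext ω
      by_cases h1 : ω ∈ Y ⁻¹' s <;> by_cases h2 : ω ∈ V ⁻¹' t <;>
        simp only [Set.indicator, Set.mem_inter_iff, Pi.mul_apply, h1, h2] <;> simp
    have iAC : Integrable ((Y ⁻¹' s ∩ V ⁻¹' t).indicator (fun _ => (1 : ℝ))) P :=
      (integrable_const _).indicator ((hY hs).inter (hV ht))
    have sC : StronglyMeasurable[m] ((V ⁻¹' t).indicator (fun _ => (1 : ℝ))) :=
      stronglyMeasurable_const.indicator (hV' ht)
    have e1 : P⟦Y ⁻¹' s ∩ V ⁻¹' t | m⟧ =ᵐ[P]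
        (F ∘ W) * (V ⁻¹' t).indicator (fun _ => (1 : ℝ)) := by
      have := condExp_mul_of_stronglyMeasurable_right (μ := P) sC (hAC ▸ iAC) iA
      rw [← hAC] at this
      filter_upwards [this, hFe] with ω a b
      rw [a, Pi.mul_apply, b, Pi.mul_apply]
    have iFC : Integrable ((F ∘ W) * (V ⁻¹' t).indicator (fun _ => (1 : ℝ))) P :=
      (integrable_congr e1).1 integrable_condExp
    have e2 : P⟦Y ⁻¹' s ∩ V ⁻¹' t | m'⟧ =ᵐ[P] (F ∘ W) * P⟦V ⁻¹' t | m'⟧ :=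
      (condExp_condExp_of_le hm'm hmle).symm.trans
        ((condExp_congr_ae e1).trans
          (condExp_mul_of_stronglyMeasurable_left (μ := P) hFW iFC iC))
    have e3 : P⟦Y ⁻¹' s | m'⟧ =ᵐ[P] F ∘ W := by
      refine (condExp_condExp_of_le hm'm hmle).symm.trans ((condExp_congr_ae hFe).trans ?_)
      rw [condExp_of_stronglyMeasurable (hm'm.trans hmle) hFW
        ((integrable_congr hFe).1 integrable_condExp)]
    filter_upwards [e2, e3] with ω a b
    rw [a, b, Pi.mul_apply]

theorem aux_update {p : ℕ} (j : Fin p) :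
    Measure.QuasiMeasurePreserving (fun z : ℝ × (Fin p → ℝ) => Function.update z.2 j z.1)
      volume volume := by
  obtain _ | n := p
  · exact j.elim0
  have e := volume_preserving_piFinSuccAbove (fun _ : Fin (n + 1) => ℝ) j
  have q1 : Measure.QuasiMeasurePreserving (fun x : Fin (n + 1) → ℝ => j.removeNth x)
      volume volume := by
    have := (Measure.quasiMeasurePreserving_snd (μ := (volume : Measure ℝ))
      (ν := (volume : Measure (Fin n → ℝ)))).comp e.quasiMeasurePreserving
    exact this
  have q2 : Measure.QuasiMeasurePreserving
      (fun z : ℝ × (Fin (n + 1) → ℝ) => (z.1, j.removeNth z.2))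
      volume volume := by
    refine ⟨measurable_fst.prodMk (q1.measurable.comp measurable_snd), ?_⟩
    have := QuasiMeasurePreserving.prodMap (Measure.QuasiMeasurePreserving.id (volume : Measure ℝ)) q1
    exact this.absolutelyContinuous
  have q3 := e.symm.quasiMeasurePreserving.comp q2
  suffices hfun : (fun z : ℝ × (Fin (n + 1) → ℝ) => Function.update z.2 j z.1) =
      (MeasurableEquiv.piFinSuccAbove (fun _ : Fin (n + 1) => ℝ) j).symm ∘
        fun z : ℝ × (Fin (n + 1) → ℝ) => (z.1, j.removeNth z.2) by
    rw [hfun]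
    exact q3
  funext z
  change Function.update z.2 j z.1 = j.insertNth z.1 (j.removeNth z.2)
  rw [Fin.insertNth_removeNth]

/-- Representation of the full conditional probability through the coordinates in `S`. -/
def AuxQ {Ω : Type*} [MeasurableSpace Ω] (P : Measure Ω) {p : ℕ} (X : Fin p → Ω → ℝ)
    (h : Ω → ℝ) (S : Set (Fin p)) : Prop :=
  ∃ f : (Fin p → ℝ) → ℝ, Measurable f ∧ DependsOn f S ∧ h =ᵐ[P] fun ω => f (fun j => X j ω)

theorem aux_inter_s2 {Ω : Type*} [MeasurableSpace Ω] (P : Measure Ω) {p : ℕ} (X : Fin p → Ω → ℝ)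
    (hX : ∀ j, Measurable (X j)) (h : Ω → ℝ)
    (h1 : volume ≪ P.map (fun ω j => X j ω)) (h2 : P.map (fun ω j => X j ω) ≪ volume)
    (S : Set (Fin p)) (j : Fin p) (hS : AuxQ P X h S) (hj : AuxQ P X h {j}ᶜ) :
    AuxQ P X h (S \ {j}) := by
  obtain ⟨f, hf, fS, hfe⟩ := hS
  obtain ⟨g, hg, gS, hge⟩ := hj
  have hXm : Measurable (fun ω j => X j ω) := measurable_pi_lambda _ hX
  have e1 : f =ᵐ[volume] g := by
    refine h1.ae_le ?_
    exact (ae_map_iff hXm.aemeasurable (measurableSet_eq_fun hf hg)).2 (hfe.symm.trans hge)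
  have e2 := Measure.ae_ae_of_ae_prod ((aux_update j).ae e1)
  obtain ⟨t, ht⟩ := e2.exists
  refine ⟨fun x => f (Function.update x j t), hf.comp ?_, ?_, ?_⟩
  · exact measurable_update_left
  · intro x y hxy
    apply fS
    intro i hi
    by_cases hij : i = j
    · subst hij; simp
    · simpa [hij] using hxy i ⟨hi, hij⟩
  · have := ae_of_ae_map hXm.aemeasurable (h2.ae_le ht)
    filter_upwards [this, hge] with ω a b
    rw [b, a]
    apply gS
    intro i hi
    simp only [Set.mem_compl_iff, Set.mem_singleton_iff] at hi
    simp [hi]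

theorem aux_iff {Ω γ : Type*} [mΩ : MeasurableSpace Ω] [StandardBorelSpace Ω]
    [mγ : MeasurableSpace γ] [StandardBorelSpace γ] [Nonempty γ]
    (P : Measure Ω) [IsFiniteMeasure P] {p : ℕ} (Y : Ω → ℝ) (X : Fin p → Ω → ℝ)
    (hY : Measurable Y) (hX : ∀ j, Measurable (X j)) (S : Set (Fin p))
    (V : Ω → γ) (hV : Measurable[MeasurableSpace.comap (fun ω j => X j ω) inferInstance] V)
    (hV' : ∀ j, j ∉ S → Measurable[mγ.comap V] (X j))
    (hW : Measurable (fun ω (j : S) => X j.1 ω)) :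
    CondIndepFunGiven Y V (fun ω (j : S) => X j.1 ω) hW P ↔
      ∀ s, MeasurableSet s → AuxQ P X
        (P⟦Y ⁻¹' s | MeasurableSpace.comap (fun ω j => X j ω) inferInstance⟧) S := by
  have hXm : Measurable (fun ω j => X j ω) := measurable_pi_lambda _ hX
  rw [aux_condIndep Y V _ hY (hV.mono hXm.comap_le le_rfl)]
  have hcomap : MeasurableSpace.comap (fun ω => ((fun (j : S) => X j.1 ω), V ω)) inferInstance
      = MeasurableSpace.comap (fun ω j => X j ω) inferInstance := by
    apply le_antisymm
    · apply Measurable.comap_le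
      refine Measurable.prodMk ?_ hV
      refine @measurable_pi_lambda _ _ _ (_) _ _ ?_
      intro j
      exact (measurable_pi_apply j.1).comp (comap_measurable (fun ω j => X j ω))
    · apply Measurable.comap_le
      refine @measurable_pi_lambda _ _ _ (_) _ _ ?_
      intro j
      have hc := comap_measurable (m := inferInstance) (fun ω => ((fun (j : S) => X j.1 ω), V ω))
      by_cases hj : j ∈ S
      · exact (measurable_pi_apply (⟨j, hj⟩ : S)).comp (measurable_fst.comp hc)
      · exact (hV' j hj).mono (measurable_snd.comp hc).comap_le le_rfl
  rw [hcomap]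
  refine forall₂_congr fun s hs => ?_
  constructor
  · rintro ⟨F, hF, e⟩
    refine ⟨fun x => F (fun j : S => x j.1), hF.comp (by fun_prop), ?_, e⟩
    intro x y hxy
    exact congrArg F (funext fun j => hxy j.1 j.2)
  · classical
    rintro ⟨f, hf, fS, e⟩
    refine ⟨fun u => f (fun j => if hj : j ∈ S then u ⟨j, hj⟩ else 0), hf.comp ?_, ?_⟩
    · refine @measurable_pi_lambda _ _ _ (_) _ _ ?_
      intro j
      by_cases hj : j ∈ S
      · simp only [hj, dite_true]; fun_prop
      · simp only [hj, dite_false]; fun_prop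
    · filter_upwards [e] with ω a
      rw [a]
      apply fS
      intro i hi
      simp [hi]

/-- Suppose the joint law of `(Y, X₁, …, X_p)` has an a.e. strictly positive
density with respect to Lebesgue measure on `ℝ^{p+1}`.  Let
`pa := { j : Y and X_j are NOT conditionally independent given (X_k)_{k ≠ j} }`.  Then
(i) `Y` is conditionally independent of `(X_j)_{j ∉ pa}` given `(X_j)_{j ∈ pa}`, and
(ii) `pa` is contained in every set `S` such that `Y` is conditionally independent of
`(X_j)_{j ∉ S}` given `(X_j)_{j ∈ S}`. -/
theorem stmt_2 {Ω : Type*} [MeasurableSpace Ω] [StandardBorelSpace Ω]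
    (P : Measure Ω) [IsProbabilityMeasure P] {p : ℕ}
    (Y : Ω → ℝ) (X : Fin p → Ω → ℝ)
    (hY : Measurable Y) (hX : ∀ j, Measurable (X j))
    (g : ℝ × (Fin p → ℝ) → ENNReal) (hg : Measurable g)
    (hlaw : Measure.map (fun ω => (Y ω, fun j => X j ω)) P
      = (volume : Measure (ℝ × (Fin p → ℝ))).withDensity g)
    (hpos : ∀ᵐ x ∂(volume : Measure (ℝ × (Fin p → ℝ))), 0 < g x)
    (pa : Set (Fin p))
    (hpa : pa = {j : Fin p | ¬ CondIndepFunGiven Y (X j)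
      (fun ω (k : {k : Fin p // k ≠ j}) => X k.1 ω)
      (measurable_pi_lambda _ fun k => hX k.1) P}) :
    (CondIndepFunGiven Y
      (fun ω (j : {j : Fin p // j ∉ pa}) => X j.1 ω)
      (fun ω (j : pa) => X j.1 ω)
      (measurable_pi_lambda _ fun j => hX j.1) P)
    ∧ ∀ S : Set (Fin p),
      CondIndepFunGiven Y
        (fun ω (j : {j : Fin p // j ∉ S}) => X j.1 ω)
        (fun ω (j : S) => X j.1 ω)
        (measurable_pi_lambda _ fun j => hX j.1) P
      → pa ⊆ S := by
  have hXm : Measurable (fun ω j => X j ω) := measurable_pi_lambda _ hX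
  have hmap : P.map (fun ω j => X j ω) = (volume.withDensity g).map Prod.snd := by
    rw [← hlaw, Measure.map_map measurable_snd (hY.prodMk hXm)]
    rfl
  have h2 : P.map (fun ω j => X j ω) ≪ volume := by
    rw [hmap]
    exact ((withDensity_absolutelyContinuous _ _).map measurable_snd).trans
      (Measure.quasiMeasurePreserving_snd (μ := (volume : Measure ℝ))).absolutelyContinuous
  have h1 : volume ≪ P.map (fun ω j => X j ω) := by
    rw [hmap]
    refine Measure.AbsolutelyContinuous.mk fun N hN h0 => ?_
    rw [Measure.map_apply measurable_snd hN] at h0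
    have h3 := withDensity_absolutelyContinuous' hg.aemeasurable
      (hpos.mono fun x hx => hx.ne') h0
    rw [← Set.univ_prod, Measure.volume_eq_prod, Measure.prod_prod] at h3
    simpa using h3
  set H : Set ℝ → Ω → ℝ := fun s =>
    P⟦Y ⁻¹' s | MeasurableSpace.comap (fun ω j => X j ω) inferInstance⟧ with hH
  have iffS : ∀ S : Set (Fin p), CondIndepFunGiven Y
        (fun ω (j : {j : Fin p // j ∉ S}) => X j.1 ω)
        (fun ω (j : S) => X j.1 ω)
        (measurable_pi_lambda _ fun j => hX j.1) P ↔
        ∀ s, MeasurableSet s → AuxQ P X (H s) S := by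
    intro S
    refine aux_iff (γ := {j : Fin p // j ∉ S} → ℝ) P Y X hY hX S _ ?_ ?_ _
    · refine @measurable_pi_lambda _ _ _ (_) _ _ ?_
      intro j
      exact (measurable_pi_apply j.1).comp (comap_measurable (fun ω j => X j ω))
    · intro j hj
      exact (measurable_pi_apply (⟨j, hj⟩ : {j : Fin p // j ∉ S})).comp (comap_measurable
        (fun ω (j : {j : Fin p // j ∉ S}) => X j.1 ω))
  have iffj : ∀ j : Fin p, CondIndepFunGiven Y (X j)
      (fun ω (k : {k : Fin p // k ≠ j}) => X k.1 ω)
      (measurable_pi_lambda _ fun k => hX k.1) P ↔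
        ∀ s, MeasurableSet s → AuxQ P X (H s) {j}ᶜ := by
    intro j
    refine aux_iff (γ := ℝ) P Y X hY hX {j}ᶜ (X j) ?_ ?_ _
    · exact (measurable_pi_apply j).comp (comap_measurable (fun ω j => X j ω))
    · intro i hi
      obtain rfl : i = j := by simpa using hi
      exact comap_measurable _
  constructor
  · rw [iffS]
    intro s hs
    have key : ∀ T : Finset (Fin p), (∀ j ∈ T, j ∉ pa) → AuxQ P X (H s) (Set.univ \ ↑T) := by
      intro T
      induction T using Finset.induction_on with
      | empty =>
        intro _
        obtain ⟨F, hF, e⟩ := (stronglyMeasurable_condExp (μ := P)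
          (f := (Y ⁻¹' s).indicator fun _ => (1 : ℝ))
          (m := MeasurableSpace.comap (fun ω j => X j ω) inferInstance)).exists_eq_measurable_comp
        refine ⟨F, hF.measurable, ?_, ?_⟩
        · intro x y hxy
          rw [funext fun i => hxy i (by simp)]
        · exact Filter.Eventually.of_forall fun ω => congrFun e ω
      | insert j T hj ih =>
        intro hT
        have a := ih fun i hi => hT i (Finset.mem_insert_of_mem hi)
        have hjp := hT j (Finset.mem_insert_self _ _)
        rw [hpa, Set.mem_ofPred_eq, not_not, iffj] at hjp
        have b := aux_inter_s2 P X hX (H s) h1 h2 _ j a (hjp s hs)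
        convert b using 1
        ext i
        simp [not_or, and_comm]
    classical
    have := key (Finset.univ.filter (fun j => j ∉ pa)) (by simp)
    convert this using 1
    ext i
    simp
  · intro S hS j hj
    by_contra hjS
    rw [iffS] at hS
    rw [hpa, Set.mem_ofPred_eq, iffj] at hj
    apply hj
    intro s hs
    obtain ⟨f, hf, fS, e⟩ := hS s hs
    refine ⟨f, hf, fun x y hxy => fS fun i hi => hxy i ?_, e⟩
    rintro rfl
    exact hjS hi
end

section
/- Let Y be a real-valued random variable and (X_j)_{j∈P} a finite family of real-valued random variables with |P| = p. Suppose S ⊆ P satisfies Y ⫫ (X_j)_{j∈P∖S} | (X_j)_{j∈S} and |S| ≤ q ≤ p−1. Then for every j ∈ P∖S there exists a subset Q ⊆ P∖{j} with |Q| = q such that Y ⫫ X_j | (X_k)_{k∈Q}. Consequently, if j ∈ P is such that Y and X_j are conditionally dependent given (X_k)_{k∈Q} for EVERY Q ⊆ P∖{j} with |Q| = q (i.e. the edge towards Y from X_j belongs to the q-th order conditional dependence graph), then j ∈ S. (This is the single-node probabilistic content of the paper's Proposition 4 and Corollary 1: if a node has at most q parents, every non-edge of the full-order DAG G̃ is a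 non-edge of the q-th order DAG G^{(q)}, i.e. G^{(q)} ⊆ G̃.) -/
open MeasureTheory ProbabilityTheory

theorem aux_sup_pi {Ω : Type*} (m₁ m₂ : MeasurableSpace Ω) :
    m₁ ⊔ m₂ = MeasurableSpace.generateFrom
      {s | ∃ C B, MeasurableSet[m₁] C ∧ MeasurableSet[m₂] B ∧ s = C ∩ B} := by
  apply le_antisymm
  · refine sup_le ?_ ?_
    · intro C hC
      exact MeasurableSpace.measurableSet_generateFrom
        ⟨C, Set.univ, hC, @MeasurableSet.univ _ m₂, by simp⟩
    · intro B hB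
      exact MeasurableSpace.measurableSet_generateFrom
        ⟨Set.univ, B, @MeasurableSet.univ _ m₁, hB, by simp⟩
  · refine MeasurableSpace.generateFrom_le ?_
    rintro s ⟨C, B, hC, hB, rfl⟩
    exact @MeasurableSet.inter _ (m₁ ⊔ m₂) _ _
      ((le_sup_left : m₁ ≤ m₁ ⊔ m₂) _ hC) ((le_sup_right : m₂ ≤ m₁ ⊔ m₂) _ hB)

theorem aux_condExp_sup {Ω : Type*} {m' m₁ m₂ : MeasurableSpace Ω}
    {mΩ : MeasurableSpace Ω} [StandardBorelSpace Ω] (hm' : m' ≤ mΩ) (hm₁ : m₁ ≤ mΩ) (hm₂ : m₂ ≤ mΩ)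
    (μ : Measure Ω) [IsFiniteMeasure μ] (h : CondIndep m' m₁ m₂ hm' μ)
    {A : Set Ω} (hA : MeasurableSet[m₁] A) :
    μ⟦A | m'⟧ =ᵐ[μ] μ⟦A | m' ⊔ m₂⟧ := by
  rw [condIndep_iff m' m₁ m₂ hm' hm₁ hm₂] at h
  have hG : m' ⊔ m₂ ≤ mΩ := sup_le hm' hm₂
  have hint : ∀ s, MeasurableSet[mΩ] s → Integrable (s.indicator (fun _ => (1:ℝ))) μ :=
    fun s hs => (integrable_const _).indicator hs
  have hAi := hint A (hm₁ _ hA)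
  have hgi : Integrable (μ⟦A | m'⟧) μ := integrable_condExp
  have hgm : StronglyMeasurable[m' ⊔ m₂] (μ⟦A | m'⟧) :=
    (stronglyMeasurable_condExp (m := m')).mono le_sup_left
  refine ae_eq_condExp_of_forall_setIntegral_eq hG hAi (fun s _ _ => hgi.integrableOn) ?_
    hgm.aestronglyMeasurable
  intro s hs _
  refine MeasurableSpace.induction_on_inter (m := m' ⊔ m₂)
    (C := fun s _ => ∫ x in s, (μ⟦A | m'⟧) x ∂μ
      = ∫ x in s, A.indicator (fun _ => (1:ℝ)) x ∂μ) (aux_sup_pi m' m₂) ?_ ?_ ?_ ?_ ?_ s hs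
  · rintro _ ⟨C, B, hC, hB, rfl⟩ _ ⟨C', B', hC', hB', rfl⟩ _
    exact ⟨C ∩ C', B ∩ B', hC.inter hC', hB.inter hB', Set.inter_inter_inter_comm _ _ _ _⟩
  · simp
  · rintro _ ⟨C, B, hC, hB, rfl⟩
    have hB' := hm₂ _ hB
    have hBi := hint B hB'
    have e1 : ∀ f : Ω → ℝ, B.indicator f = f * B.indicator (fun _ => (1:ℝ)) := by
      intro f; ext x; by_cases hx : x ∈ B <;> simp [hx]
    have e2 : B.indicator (A.indicator (fun _ => (1:ℝ)))
        = (A ∩ B).indicator (fun _ => (1:ℝ)) := by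
      rw [Set.indicator_indicator, Set.inter_comm]
    rw [← setIntegral_indicator hB', ← setIntegral_indicator hB', e2]
    have i1 : Integrable ((μ⟦A | m'⟧) * B.indicator (fun _ => (1:ℝ))) μ := by
      rw [← e1]; exact hgi.indicator hB'
    have p1 : μ[(μ⟦A | m'⟧) * B.indicator (fun _ => (1:ℝ)) | m'] =ᵐ[μ] μ⟦A ∩ B | m'⟧ :=
      (condExp_mul_of_stronglyMeasurable_left stronglyMeasurable_condExp i1 hBi).trans
        (h A B hA hB).symm
    rw [e1, ← setIntegral_condExp hm' i1 hC,
      ← setIntegral_condExp hm' (hint _ ((hm₁ _ hA).inter hB')) hC]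
    exact integral_congr_ae (ae_restrict_of_ae p1)
  · intro t ht ih
    have h1 := integral_add_compl (hG _ ht) hgi
    have h2 := integral_add_compl (hG _ ht) hAi
    have h3 : ∫ x, (μ⟦A | m'⟧) x ∂μ = ∫ x, A.indicator (fun _ => (1:ℝ)) x ∂μ :=
      integral_condExp hm'
    linarith
  · intro f hd hf ih
    rw [integral_iUnion (fun i => hG _ (hf i)) hd hgi.integrableOn,
      integral_iUnion (fun i => hG _ (hf i)) hd hAi.integrableOn]
    exact tsum_congr ih

theorem aux_weak_union {Ω : Type*} {m' m₁ m₂ m : MeasurableSpace Ω}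
    {mΩ : MeasurableSpace Ω} [StandardBorelSpace Ω] (hm' : m' ≤ mΩ) (hm₁ : m₁ ≤ mΩ) (hm₂ : m₂ ≤ mΩ)
    (hm : m ≤ mΩ) (h1 : m' ≤ m) (h2 : m ≤ m' ⊔ m₂)
    (μ : Measure Ω) [IsFiniteMeasure μ] (h : CondIndep m' m₁ m₂ hm' μ) :
    CondIndep m m₁ m₂ hm μ := by
  rw [condIndep_iff m m₁ m₂ hm hm₁ hm₂]
  intro A B hA hB
  have hG : m' ⊔ m₂ ≤ mΩ := sup_le hm' hm₂
  have hint : ∀ s, MeasurableSet[mΩ] s → Integrable (s.indicator (fun _ => (1:ℝ))) μ :=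
    fun s hs => (integrable_const _).indicator hs
  have key := aux_condExp_sup hm' hm₁ hm₂ μ h hA
  have hgi : Integrable (μ⟦A | m'⟧) μ := integrable_condExp
  have hgm : StronglyMeasurable[m] (μ⟦A | m'⟧) := stronglyMeasurable_condExp.mono h1
  have hB' := hm₂ _ hB
  have e1 : ∀ f : Ω → ℝ, B.indicator f = f * B.indicator (fun _ => (1:ℝ)) := by
    intro f; ext x; by_cases hx : x ∈ B <;> simp [hx]
  have e2 : (A ∩ B).indicator (fun _ => (1:ℝ))
      = A.indicator (fun _ => (1:ℝ)) * B.indicator (fun _ => (1:ℝ)) := by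
    rw [← e1, Set.indicator_indicator, Set.inter_comm]
  have i1 : Integrable ((μ⟦A | m'⟧) * B.indicator (fun _ => (1:ℝ))) μ := by
    rw [← e1]; exact hgi.indicator hB'
  have hAB := hint _ ((hm₁ _ hA).inter hB')
  have hBm : StronglyMeasurable[m' ⊔ m₂] (B.indicator (fun _ => (1:ℝ))) :=
    (@stronglyMeasurable_const _ _ (m' ⊔ m₂) _ _).indicator
      ((le_sup_right : m₂ ≤ m' ⊔ m₂) _ hB)
  have q1 : μ⟦A | m⟧ =ᵐ[μ] μ⟦A | m'⟧ := by
    refine (condExp_condExp_of_le h2 hG).symm.trans ((condExp_congr_ae key.symm).trans ?_)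
    rw [condExp_of_stronglyMeasurable hm hgm hgi]
  have q2 : μ⟦A ∩ B | m' ⊔ m₂⟧ =ᵐ[μ] (μ⟦A | m'⟧) * B.indicator (fun _ => (1:ℝ)) := by
    rw [e2] at hAB ⊢
    refine (condExp_mul_of_stronglyMeasurable_right hBm hAB (hint _ (hm₁ _ hA))).trans ?_
    exact key.symm.mul Filter.EventuallyEq.rfl
  refine (condExp_condExp_of_le h2 hG).symm.trans ((condExp_congr_ae q2).trans ?_)
  refine (condExp_mul_of_stronglyMeasurable_left hgm i1 (hint _ hB')).trans ?_
  exact q1.symm.mul Filter.EventuallyEq.rfl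

theorem aux_comap_le {Ω κ : Type*} (m : MeasurableSpace Ω) (Z : κ → Ω → ℝ)
    (h : ∀ k, Measurable[m] (Z k)) :
    MeasurableSpace.comap (fun ω (k : κ) => Z k ω) inferInstance ≤ m :=
  (@measurable_pi_lambda Ω κ _ m _ (fun ω (k : κ) => Z k ω) h).comap_le

/-- Suppose `Y ⫫ (X_j)_{j ∉ S} | (X_j)_{j ∈ S}` with `|S| ≤ q ≤ p − 1`, where
`p = |P|`.  Then (i) for every `j ∉ S` there is a `Q ⊆ P∖{j}` with `|Q| = q` and
`Y ⫫ X_j | (X_k)_{k ∈ Q}`; and (ii) if `Y` and `X_j` are conditionally dependent given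
`(X_k)_{k ∈ Q}` for every `Q ⊆ P∖{j}` with `|Q| = q`, then `j ∈ S`. -/
theorem stmt_4 {Ω ι : Type*} [MeasurableSpace Ω] [StandardBorelSpace Ω]
    [Fintype ι] [DecidableEq ι]
    (P : Measure Ω) [IsProbabilityMeasure P] (p q : ℕ) (hcard : Fintype.card ι = p)
    (Y : Ω → ℝ) (X : ι → Ω → ℝ)
    (hY : Measurable Y) (hX : ∀ j, Measurable (X j))
    (S : Finset ι) (hSq : S.card ≤ q) (hqp : q ≤ p - 1)
    (hS : CondIndepFunGiven Y
      (fun ω (j : {j : ι // j ∉ S}) => X j.1 ω)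
      (fun ω (j : {j : ι // j ∈ S}) => X j.1 ω)
      (measurable_pi_lambda _ fun j => hX j.1) P) :
    (∀ j ∉ S, ∃ Q : Finset ι, j ∉ Q ∧ Q.card = q ∧
      CondIndepFunGiven Y (X j)
        (fun ω (k : {k : ι // k ∈ Q}) => X k.1 ω)
        (measurable_pi_lambda _ fun k => hX k.1) P)
    ∧ ∀ j : ι,
      (∀ Q : Finset ι, j ∉ Q → Q.card = q →
        ¬ CondIndepFunGiven Y (X j)
          (fun ω (k : {k : ι // k ∈ Q}) => X k.1 ω)
          (measurable_pi_lambda _ fun k => hX k.1) P)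
      → j ∈ S := by
  have main : ∀ j ∉ S, ∃ Q : Finset ι, j ∉ Q ∧ Q.card = q ∧
      CondIndepFunGiven Y (X j)
        (fun ω (k : {k : ι // k ∈ Q}) => X k.1 ω)
        (measurable_pi_lambda _ fun k => hX k.1) P := by
    intro j hj
    have hSj : S ⊆ Finset.univ.erase j := fun k hk =>
      Finset.mem_erase.2 ⟨fun e => hj (e ▸ hk), Finset.mem_univ _⟩
    obtain ⟨Q, hSQ, hQj, hQc⟩ := Finset.exists_subsuperset_card_eq (n := q) hSj hSq
      (by rw [Finset.card_erase_of_mem (Finset.mem_univ _), Finset.card_univ, hcard]; exact hqp)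
    refine ⟨Q, fun h => (Finset.mem_erase.1 (hQj h)).1 rfl, hQc, ?_⟩
    unfold CondIndepFunGiven at hS ⊢
    rw [condIndepFun_iff_condIndep] at hS ⊢
    have hXS : ∀ k, k ∈ S → Measurable[MeasurableSpace.comap
        (fun ω (j : {j : ι // j ∈ S}) => X j.1 ω) inferInstance] (X k) := fun k hk =>
      (measurable_pi_apply (⟨k, hk⟩ : {j : ι // j ∈ S})).comp
        (comap_measurable (fun ω (j : {j : ι // j ∈ S}) => X j.1 ω))
    have hXQ : ∀ k, k ∈ Q → Measurable[MeasurableSpace.comap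
        (fun ω (j : {j : ι // j ∈ Q}) => X j.1 ω) inferInstance] (X k) := fun k hk =>
      (measurable_pi_apply (⟨k, hk⟩ : {j : ι // j ∈ Q})).comp
        (comap_measurable (fun ω (j : {j : ι // j ∈ Q}) => X j.1 ω))
    have hXN : ∀ k, k ∉ S → Measurable[MeasurableSpace.comap
        (fun ω (j : {j : ι // j ∉ S}) => X j.1 ω) inferInstance] (X k) := fun k hk =>
      (measurable_pi_apply (⟨k, hk⟩ : {j : ι // j ∉ S})).comp
        (comap_measurable (fun ω (j : {j : ι // j ∉ S}) => X j.1 ω))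
    have hN : MeasurableSpace.comap (fun ω (j : {j : ι // j ∉ S}) => X j.1 ω) inferInstance
        ≤ (inferInstance : MeasurableSpace Ω) :=
      aux_comap_le _ (fun k : {j : ι // j ∉ S} => X k.1) fun k => hX k.1
    refine condIndep_of_condIndep_of_le_right (aux_weak_union _ hY.comap_le
      hN _ ?_ ?_ P hS) (hXN j hj).comap_le
    · exact aux_comap_le _ (fun k : {j : ι // j ∈ S} => X k.1) fun k => hXQ k.1 (hSQ k.2)
    · refine aux_comap_le _ (fun k : {j : ι // j ∈ Q} => X k.1) fun k => ?_
      by_cases hk : k.1 ∈ S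
      · exact (hXS _ hk).mono le_sup_left le_rfl
      · exact (hXN _ hk).mono le_sup_right le_rfl
  refine ⟨main, fun j hj => ?_⟩
  by_contra hjS
  obtain ⟨Q, h1, h2, h3⟩ := main j hjS
  exact hj Q h1 h2 h3
end

section
/- Let Σ be a positive definite real p×p matrix, A an arbitrary real p×p matrix, and set C := A·Σ. Fix j ∈ {1,…,p} and let S := {1,…,p}∖{j}. Then for every i ∈ {1,…,p}: C_{i j} − C_{i,S}(Σ_{S,S})⁻¹Σ_{S,j} = A_{i j} · (Σ_{j j} − Σ_{j,S}(Σ_{S,S})⁻¹Σ_{S,j}), where C_{i,S} := (C_{i s})_{s∈S} and Σ_{j,S} := (Σ_{j s})_{s∈S} are row vectors and Σ_{S,j} := (Σ_{s j})_{s∈S} is a column vector, and Σ_{S,S} is the (positive definite, hence invertible) principal submatrix of Σ on S. (If Σ is the covariance matrix of X_{t−1} and X_t = A X_{t−1} + B + ε_t with ε_t uncorrelated with X_{t−1}, so that C = Cov(X_t, X_{t−1}), this identity is exactly the paper's formula a_{ij} = Cov(X_t^i, X_{t−1}^j | X_{t−1}^{P∖{j}}) / Var(X_{t−1}^j | X_{t−1}^{P∖{j}})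 from Section 1.2.) -/
open scoped BigOperators

/-- Let `M` be a positive definite `p×p` matrix, `A` an arbitrary `p×p` matrix
and `C := A·M`.  Fix `j` and let `S := {1,…,p}∖{j}`.  Then for every `i`,
`C_{ij} − C_{i,S}(M_{S,S})⁻¹ M_{S,j} = A_{ij}·(M_{jj} − M_{j,S}(M_{S,S})⁻¹ M_{S,j})`. -/
theorem stmt_12 {p : ℕ} (M : Matrix (Fin p) (Fin p) ℝ) (hM : M.PosDef)
    (A : Matrix (Fin p) (Fin p) ℝ) (j : Fin p) :
    ∀ i : Fin p,
      (A * M) i j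
        - ∑ s : {k : Fin p // k ≠ j}, ∑ s' : {k : Fin p // k ≠ j},
            (A * M) i s.1 *
              (M.submatrix (Subtype.val : {k : Fin p // k ≠ j} → Fin p)
                (Subtype.val : {k : Fin p // k ≠ j} → Fin p))⁻¹ s s' * M s'.1 j
      = A i j *
        (M j j
          - ∑ s : {k : Fin p // k ≠ j}, ∑ s' : {k : Fin p // k ≠ j},
              M j s.1 *
                (M.submatrix (Subtype.val : {k : Fin p // k ≠ j} → Fin p)
                  (Subtype.val : {k : Fin p // k ≠ j} → Fin p))⁻¹ s s' * M s'.1 j) := by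
  intro i
  have hN : (M.submatrix (Subtype.val : {k : Fin p // k ≠ j} → Fin p)
      (Subtype.val : {k : Fin p // k ≠ j} → Fin p)).PosDef :=
    hM.submatrix Subtype.val_injective
  have hinv := Matrix.mul_nonsing_inv _ ((Matrix.isUnit_iff_isUnit_det _).1 hN.isUnit)
  generalize hB : (M.submatrix (Subtype.val : {k : Fin p // k ≠ j} → Fin p)
      (Subtype.val : {k : Fin p // k ≠ j} → Fin p))⁻¹ = B at hinv ⊢
  obtain ⟨w, hw⟩ : ∃ w : {k : Fin p // k ≠ j} → ℝ, w = fun s => ∑ s', B s s' * M s'.1 j :=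
    ⟨_, rfl⟩
  have e (f : {k : Fin p // k ≠ j} → ℝ) :
      ∑ s, ∑ s', f s * B s s' * M s'.1 j = ∑ s, f s * w s := by
    simp only [hw, Finset.mul_sum, mul_assoc]
  have key (k : Fin p) (hk : k ≠ j) : ∑ s : {k : Fin p // k ≠ j}, M k s.1 * w s = M k j := by
    rw [← e, Finset.sum_comm]
    have h (s' : {k : Fin p // k ≠ j}) : ∑ s : {k : Fin p // k ≠ j}, M k s.1 * B s s'
        = (1 : Matrix {k : Fin p // k ≠ j} {k : Fin p // k ≠ j} ℝ) ⟨k, hk⟩ s' := by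
      rw [← hinv, Matrix.mul_apply]
      rfl
    simp only [← Finset.sum_mul, h, Matrix.one_apply]
    simp
  rw [e (fun s => (A * M) i s.1), e (fun s => M j s.1)]
  have h2 : ∑ s : {k : Fin p // k ≠ j}, (A * M) i s.1 * w s
      = ∑ k, A i k * ∑ s : {k : Fin p // k ≠ j}, M k s.1 * w s := by
    simp only [Matrix.mul_apply, Finset.sum_mul, Finset.mul_sum, mul_assoc]
    rw [Finset.sum_comm]
  rw [h2, Matrix.mul_apply, ← Finset.sum_sub_distrib]
  rw [Finset.sum_eq_single j]
  · ring
  · intro k _ hk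
    rw [key k hk, sub_self]
  · simp
end
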